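/- Let m > n be positive integers and let α be a composition of n. Then the statistics ret, run and r̃un are equidistributed on D_{m,α}: ∑_{P ∈ D_{m,α}} q^{ret(P)} = ∑_{P ∈ D_{m,α}} q^{run(P)} = ∑_{P ∈ D_{m,α}} q^{r̃un(P)} as polynomials in the indeterminate q. -/

import Mathlib

open scoped Classical

namespace RationalDyck

/-- A lattice path: `true` = a north step `N`, `false` = an east step `E`. -/
abbrev Path : Type := List Bool

/-- The rank of the endpoint of a path prefix `Q` in the `m × n` grid:
`rank(i,j) = j*m - i*n`, where `i` is the number of east steps of `Q`
and `j` the number of north steps of `Q`. -/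
def prefRank (m n : ℕ) (Q : Path) : ℤ :=
  (Q.count true : ℤ) * m - (Q.count false : ℤ) * n

/-- `P` is an `m × n` rational Dyck path: it goes from `(0,0)` to `(m,n)` and
stays weakly above the line `y = n x / m`. -/
def IsDyck (m n : ℕ) (P : Path) : Prop :=
  P.count false = m ∧ P.count true = n ∧ ∀ i ≤ P.length, 0 ≤ prefRank m n (P.take i)

/-- The return statistic: the number of lattice points on `P` other than `(m,n)`
whose rank is strictly less than `n`. -/
def retStat (m n : ℕ) (P : Path) : ℕ :=
  ((List.range P.length).filter fun i => prefRank m n (P.take i) < (n : ℤ)).length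

/-- The coarea sequence of `P`: for each north step (from bottom to top), the number
of cells of the rectangle strictly to its left, i.e. the number of east steps before it. -/
def coarea (P : Path) : List ℕ :=
  (List.range P.length).filterMap fun i =>
    if P.getD i false = true then some ((P.take i).count false) else none

/-- The run statistic: the least `i ∈ [n]` not appearing in the coarea sequence. -/
noncomputable def runStat (P : Path) : ℕ :=
  sInf {i : ℕ | 1 ≤ i ∧ i ≤ P.count true ∧ i ∉ coarea P}

/-- The ratio-run statistic: with `k = ⌊m/n⌋`, the least `i ∈ [n]` such that `k*i`
does not appear in the coarea sequence. -/
noncomputable def ratioRun (m n : ℕ) (P : Path) : ℕ :=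
  sInf {i : ℕ | 1 ≤ i ∧ i ≤ P.count true ∧ (m / n) * i ∉ coarea P}

/-- The composition type of `P`: the lengths of the maximal blocks of consecutive
north steps, read from start to end. -/
def compType (P : Path) : List ℕ :=
  ((P.splitOn false).map List.length).filter fun x => x ≠ 0

/-- The number of maximal blocks of consecutive north steps (vertical components). -/
def nc (P : Path) : ℕ := (compType P).length

/-- `α` is a (strong) composition of `n`. -/
def IsComposition (n : ℕ) (α : List ℕ) : Prop :=
  (∀ a ∈ α, 0 < a) ∧ α.sum = n

/-- The finite set of all `m × n` rational Dyck paths. -/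
noncomputable def dyckPaths (m n : ℕ) : Finset Path :=
  ((Finset.univ : Finset (Fin (m + n) → Bool)).image List.ofFn).filter fun P => IsDyck m n P

/-- The `m × n` rational Dyck paths of composition type `α`. -/
noncomputable def dyckPathsComp (m n : ℕ) (α : List ℕ) : Finset Path :=
  (dyckPaths m n).filter fun P => compType P = α

/-- The `m × n` rational Dyck paths with `run = k` and `ret = l`. -/
noncomputable def dyckPathsRR (m n k l : ℕ) : Finset Path :=
  (dyckPaths m n).filter fun P => runStat P = k ∧ retStat m n P = l

/-- The `m × n` rational Dyck paths of composition type `α` with `run = k` and `ret = l`. -/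
noncomputable def dyckPathsCompRR (m n : ℕ) (α : List ℕ) (k l : ℕ) : Finset Path :=
  (dyckPathsComp m n α).filter fun P => runStat P = k ∧ retStat m n P = l

/-- The number of initial parts of `α` equal to `1`. -/
def iones (α : List ℕ) : ℕ := (α.takeWhile fun a => a = 1).length

/-- `rr(α, m) = min(Iones(α) + 1, ⌈n/(m-n)⌉)` where `n = |α|` is the sum of parts. -/
def rr (m : ℕ) (α : List ℕ) : ℕ :=
  min (iones α + 1) ((α.sum + (m - α.sum) - 1) / (m - α.sum))

section Activity

theorem exists_list_pairwise_lt {ι : Type*} (E : Finset ι) {ρ : ι → ℕ} (hρ : Set.InjOn ρ E) :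
    ∃ l : List ι, l.Perm E.toList ∧ l.Pairwise fun a b => ρ b < ρ a := by
  let l := E.toList.insertionSort fun a b => ρ b ≤ ρ a
  have hp : l.Perm E.toList := List.perm_insertionSort _ _
  have : Std.Total fun a b => ρ b ≤ ρ a := ⟨fun a b => le_total _ _⟩
  have : IsTrans ι fun a b => ρ b ≤ ρ a := ⟨fun a b c h₁ h₂ => le_trans h₂ h₁⟩
  have hs : l.Pairwise fun a b => ρ b ≤ ρ a := List.pairwise_insertionSort _ _
  have hn : l.Nodup := hp.nodup_iff.2 E.nodup_toList
  refine ⟨l, hp, (hs.and hn).imp_of_mem ?_⟩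
  rintro a b ha hb ⟨hle, hne⟩
  have ha' : a ∈ E := by simpa using hp.mem_iff.1 ha
  have hb' : b ∈ E := by simpa using hp.mem_iff.1 hb
  exact lt_of_le_of_ne hle fun h => hne (hρ ha' hb' h.symm)

variable {ι : Type*} [DecidableEq ι]

/-- The basis exchange property for a finite family of finite sets. -/
def Exchange (F : Finset (Finset ι)) : Prop :=
  ∀ A ∈ F, ∀ B ∈ F, ∀ e ∈ A, e ∉ B → ∃ g ∈ B, g ∉ A ∧ insert g (A.erase e) ∈ F

/-- The members of `F` avoiding `e`. -/
def deletion (e : ι) (F : Finset (Finset ι)) : Finset (Finset ι) :=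
  F.filter fun B => e ∉ B

/-- The members of `F` containing `e`, with `e` removed. -/
def contraction (e : ι) (F : Finset (Finset ι)) : Finset (Finset ι) :=
  (F.filter fun B => e ∈ B).image fun B => B.erase e

theorem mem_deletion {e : ι} {F : Finset (Finset ι)} {B : Finset ι} :
    B ∈ deletion e F ↔ B ∈ F ∧ e ∉ B := by
  simp [deletion]

theorem mem_contraction {e : ι} {F : Finset (Finset ι)} {B : Finset ι} :
    B ∈ contraction e F ↔ e ∉ B ∧ insert e B ∈ F := by
  simp only [contraction, Finset.mem_image, Finset.mem_filter]
  constructor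
  · rintro ⟨A, ⟨hA, he⟩, rfl⟩
    exact ⟨Finset.notMem_erase _ _, by rwa [Finset.insert_erase he]⟩
  · rintro ⟨he, hB⟩
    exact ⟨_, ⟨hB, Finset.mem_insert_self _ _⟩, Finset.erase_insert he⟩

theorem exchange_deletion {F : Finset (Finset ι)} (hF : Exchange F) (e : ι) :
    Exchange (deletion e F) := by
  intro A hA B hB x hxA hxB
  rw [mem_deletion] at hA hB
  obtain ⟨g, hgB, hgA, hg⟩ := hF A hA.1 B hB.1 x hxA hxB
  refine ⟨g, hgB, hgA, mem_deletion.2 ⟨hg, ?_⟩⟩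
  grind

theorem exchange_contraction {F : Finset (Finset ι)} (hF : Exchange F) (e : ι) :
    Exchange (contraction e F) := by
  intro A hA B hB x hxA hxB
  rw [mem_contraction] at hA hB
  obtain ⟨g, hgB, hgA, hg⟩ := hF _ hA.2 _ hB.2 x (by grind) (by grind)
  have hge : g ≠ e := by grind
  refine ⟨g, by grind, by grind, mem_contraction.2 ⟨by grind, ?_⟩⟩
  have : insert e (insert g (A.erase x)) = insert g ((insert e A).erase x) := by grind
  rwa [this]

/-- The deletion-contraction polynomial of `F`, processing the elements of the list in order. -/
noncomputable def tutte : List ι → Finset (Finset ι) → Polynomial ℚ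
  | [], F => (F.card : Polynomial ℚ)
  | e :: l, F => tutte l (deletion e F) +
      (if deletion e F = ∅ then Polynomial.X else 1) * tutte l (contraction e F)

theorem tutte_empty (l : List ι) : tutte l (∅ : Finset (Finset ι)) = 0 := by
  induction l with
  | nil => simp [tutte]
  | cons e l ih => simp [tutte, deletion, contraction, ih]

theorem deletion_comm (e f : ι) (F : Finset (Finset ι)) :
    deletion e (deletion f F) = deletion f (deletion e F) := by
  ext B; simp only [mem_deletion]; tauto

theorem contraction_comm (e f : ι) (F : Finset (Finset ι)) :
    contraction e (contraction f F) = contraction f (contraction e F) := by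
  ext B
  simp only [mem_contraction, Finset.mem_insert, Finset.insert_comm e f]
  grind

theorem contraction_deletion_comm {e f : ι} (hef : e ≠ f) (F : Finset (Finset ι)) :
    contraction e (deletion f F) = deletion f (contraction e F) := by
  ext B
  simp only [mem_contraction, mem_deletion, Finset.mem_insert]
  grind

theorem deletion_eq_empty_iff {e f : ι} (F : Finset (Finset ι)) :
    deletion e F = ∅ ↔ deletion f (deletion e F) = ∅ ∧ contraction f (deletion e F) = ∅ := by
  simp only [Finset.eq_empty_iff_forall_notMem, mem_contraction, mem_deletion]
  constructor
  · intro h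
    exact ⟨fun B hB => h B hB.1, fun B hB => h _ hB.2⟩
  · rintro ⟨h₁, h₂⟩ B hB
    by_cases hf : f ∈ B
    · exact h₂ (B.erase f) ⟨Finset.notMem_erase _ _, by rwa [Finset.insert_erase hf]⟩
    · exact h₁ B ⟨hB, hf⟩

theorem Exchange.contraction_deletion_ne_empty {F : Finset (Finset ι)} (hF : Exchange F) {e f : ι}
    (hef : e ≠ f) (hD : deletion f (deletion e F) ≠ ∅)
    (hC : contraction f (contraction e F) ≠ ∅) : contraction f (deletion e F) ≠ ∅ := by
  obtain ⟨B, hB⟩ := Finset.nonempty_iff_ne_empty.2 hD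
  obtain ⟨A, hA⟩ := Finset.nonempty_iff_ne_empty.2 hC
  simp only [mem_contraction, mem_deletion] at hA hB
  obtain ⟨g, hgB, hgA, hg⟩ := hF _ hA.2.2 B hB.1.1 e (by grind) hB.1.2
  refine Finset.nonempty_iff_ne_empty.1 ⟨insert g A, ?_⟩
  simp only [mem_contraction, mem_deletion]
  have : insert f (insert g A) = insert g ((insert e (insert f A)).erase e) := by grind
  rw [this]
  grind

theorem Exchange.contraction_deletion_subset {F : Finset (Finset ι)} (hF : Exchange F) {e f : ι}
    (hef : e ≠ f) (hD : deletion f (deletion e F) = ∅) (hA : deletion f (contraction e F) ≠ ∅) :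
    contraction f (deletion e F) ⊆ deletion f (contraction e F) := by
  obtain ⟨A, hA⟩ := Finset.nonempty_iff_ne_empty.2 hA
  simp only [Finset.eq_empty_iff_forall_notMem, mem_deletion] at hD
  intro B hB
  simp only [mem_contraction, mem_deletion] at hA hB ⊢
  obtain ⟨g, hgA, hgB, hg⟩ := hF _ hB.2.1 _ hA.1.2 f (by grind) (by grind)
  have hge : g = e := by
    by_contra hge
    exact hD _ ⟨⟨hg, by grind⟩, by grind⟩
  subst hge
  rw [Finset.erase_insert hB.1] at hg
  grind

theorem Exchange.tutte_swap {F : Finset (Finset ι)} (hF : Exchange F) (e f : ι) (l : List ι) :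
    tutte (e :: f :: l) F = tutte (f :: e :: l) F := by
  rcases eq_or_ne e f with rfl | hef
  · rfl
  have hfe := hef.symm
  have h1 := deletion_eq_empty_iff (e := e) (f := f) F
  have h2 := deletion_eq_empty_iff (e := f) (f := e) F
  have h3 := hF.contraction_deletion_ne_empty hef
  have h4 := hF.contraction_deletion_ne_empty hfe
  have h5 := hF.contraction_deletion_subset hef
  have h6 := hF.contraction_deletion_subset hfe
  rw [deletion_comm e f, contraction_deletion_comm hef] at h2
  rw [deletion_comm e f, contraction_comm e f, contraction_deletion_comm hef] at h4
  rw [deletion_comm e f, contraction_deletion_comm hef] at h6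
  rw [← contraction_deletion_comm hfe] at h6
  simp only [tutte]
  rw [deletion_comm e f, contraction_comm e f, contraction_deletion_comm hef,
    ← contraction_deletion_comm hfe, if_congr h1 rfl rfl, if_congr h2 rfl rfl]
  generalize deletion f (deletion e F) = DD at *
  generalize contraction f (contraction e F) = CC at *
  generalize deletion f (contraction e F) = Ae at *
  generalize contraction f (deletion e F) = Af at *
  clear h1 h2
  by_cases hD : DD = ∅ <;> by_cases hE : Ae = ∅ <;> by_cases hG : Af = ∅
  · simp [hD, hE, hG]
  · simp [hD, hE, hG, tutte_empty]; ring
  · simp [hD, hE, hG, tutte_empty]; ring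
  · have : Ae = Af := (h6 hD hG).antisymm (h5 hD hE)
    simp [hD, hG, this]
  all_goals by_cases hC : CC = ∅
  all_goals simp_all [tutte_empty]
  all_goals ring

theorem Exchange.tutte_perm {l l' : List ι} (h : l.Perm l') :
    ∀ {F : Finset (Finset ι)}, Exchange F → tutte l F = tutte l' F := by
  induction h with
  | nil => intros; rfl
  | cons e _ ih =>
    intro F hF
    simp only [tutte, ih (exchange_deletion hF e), ih (exchange_contraction hF e)]
  | swap e f l => intro F hF; exact hF.tutte_swap _ _ _
  | trans _ _ ih₁ ih₂ => intro F hF; rw [ih₁ hF, ih₂ hF]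

/-- The internally active elements of `B` with respect to the order given by `ρ`. -/
noncomputable def active (ρ : ι → ℕ) (F : Finset (Finset ι)) (B : Finset ι) : Finset ι :=
  B.filter fun e => ∀ g, g ∉ B → ρ g < ρ e → insert g (B.erase e) ∉ F

theorem mem_active {ρ : ι → ℕ} {F : Finset (Finset ι)} {B : Finset ι} {e : ι} :
    e ∈ active ρ F B ↔ e ∈ B ∧ ∀ g, g ∉ B → ρ g < ρ e → insert g (B.erase e) ∉ F := by
  simp [active]

theorem active_deletion {ρ : ι → ℕ} {F : Finset (Finset ι)} {B : Finset ι} {e : ι}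
    (he : e ∉ B) (hρ : ∀ x ∈ B, ρ x < ρ e) : active ρ (deletion e F) B = active ρ F B := by
  ext x
  simp only [mem_active, mem_deletion]
  refine and_congr_right fun hx => forall_congr' fun g => ?_
  have := hρ x hx
  grind

theorem active_contraction {ρ : ι → ℕ} {F : Finset (Finset ι)} {B : Finset ι} {e : ι}
    (he : e ∈ B) (hρ : ∀ x ∈ B, x ≠ e → ρ x < ρ e) :
    active ρ (contraction e F) (B.erase e) = (active ρ F B).erase e := by
  ext x
  rw [Finset.mem_erase]
  simp only [mem_active, mem_contraction]
  by_cases hx : x ∈ B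
  swap
  · simp [hx]
  by_cases hxe : x = e
  · simp [hxe]
  have h := hρ x hx hxe
  simp only [Finset.mem_erase, hx, hxe, ne_eq, not_false_eq_true, and_self, true_and]
  refine forall_congr' fun g => ?_
  by_cases hg : ρ g < ρ x
  swap
  · simp [hg]
  have hge : g ≠ e := by rintro rfl; omega
  have : insert e (insert g ((B.erase e).erase x)) = insert g (B.erase x) := by grind
  rw [this]
  grind

theorem Exchange.mem_active_iff {ρ : ι → ℕ} {F : Finset (Finset ι)} (hF : Exchange F)
    {B : Finset ι} (hB : B ∈ F) {e : ι} (he : e ∈ B)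
    (hρ : ∀ C ∈ F, ∀ x ∈ C, x ≠ e → ρ x < ρ e) :
    e ∈ active ρ F B ↔ deletion e F = ∅ := by
  rw [mem_active, Finset.eq_empty_iff_forall_notMem]
  constructor
  · rintro ⟨-, h⟩ C hC
    rw [mem_deletion] at hC
    obtain ⟨g, hgC, hgB, hg⟩ := hF B hB C hC.1 e he hC.2
    exact h g hgB (hρ C hC.1 g hgC (by grind)) hg
  · intro h
    refine ⟨he, fun g hg _ hgF => h _ (mem_deletion.2 ⟨hgF, ?_⟩)⟩
    grind

theorem Exchange.sum_active {ρ : ι → ℕ} {l : List ι} (hl : l.Pairwise fun a b => ρ b < ρ a) :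
    ∀ {F : Finset (Finset ι)}, Exchange F → (∀ B ∈ F, ∀ x ∈ B, x ∈ l) →
      ∑ B ∈ F, (Polynomial.X : Polynomial ℚ) ^ (active ρ F B).card = tutte l F := by
  induction l with
  | nil =>
    intro F hF h
    have : ∀ B ∈ F, (Polynomial.X : Polynomial ℚ) ^ (active ρ F B).card = 1 := by
      intro B hB
      have : B = ∅ := Finset.eq_empty_iff_forall_notMem.2 fun x hx => by simpa using h B hB x hx
      simp [this, active]
    rw [Finset.sum_congr rfl this]
    simp [tutte]
  | cons e l ih =>
    intro F hF h
    rw [List.pairwise_cons] at hl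
    have hρ : ∀ C ∈ F, ∀ x ∈ C, x ≠ e → ρ x < ρ e := fun C hC x hx hxe =>
      hl.1 x (by simpa [hxe] using h C hC x hx)
    rw [tutte, ← ih hl.2 (exchange_deletion hF e) ?_, ← ih hl.2 (exchange_contraction hF e) ?_,
      ← Finset.sum_filter_not_add_sum_filter F (fun B => e ∈ B)]
    · congr 1
      · refine Finset.sum_congr rfl fun B hB => ?_
        replace hB := mem_deletion.1 hB
        rw [active_deletion hB.2 fun x hx => hρ B hB.1 x hx (by grind)]
      · rw [Finset.mul_sum, contraction, Finset.sum_image]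
        · refine Finset.sum_congr rfl fun B hB => ?_
          rw [Finset.mem_filter] at hB
          have h₁ := active_contraction (F := F) hB.2 (hρ B hB.1)
          rw [contraction] at h₁
          rw [h₁]
          have h₂ := hF.mem_active_iff hB.1 hB.2 hρ
          split_ifs with hd
          · rw [← pow_succ', Finset.card_erase_add_one (h₂.2 hd)]
          · rw [Finset.erase_eq_of_notMem (fun h' => hd (h₂.1 h')), one_mul]
        · intro A hA B hB hAB
          simp only [Finset.coe_filter, Set.mem_ofPred_eq] at hA hB
          rw [← Finset.insert_erase hA.2, ← Finset.insert_erase hB.2]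
          simp only at hAB
          rw [hAB]
    · intro B hB x hx
      rw [mem_contraction] at hB
      have := h _ hB.2 x (Finset.mem_insert_of_mem hx)
      grind
    · intro B hB x hx
      rw [mem_deletion] at hB
      have := h _ hB.1 x hx
      grind

/-- The distribution of internal activity does not depend on the order of the ground set. -/
theorem Exchange.sum_active_eq {F : Finset (Finset ι)} (hF : Exchange F) (E : Finset ι)
    (hE : ∀ B ∈ F, B ⊆ E) {ρ σ : ι → ℕ} (hρ : Set.InjOn ρ E) (hσ : Set.InjOn σ E) :
    ∑ B ∈ F, (Polynomial.X : Polynomial ℚ) ^ (active ρ F B).card =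
      ∑ B ∈ F, (Polynomial.X : Polynomial ℚ) ^ (active σ F B).card := by
  obtain ⟨l, hl, hl'⟩ := exists_list_pairwise_lt E hρ
  obtain ⟨k, hk, hk'⟩ := exists_list_pairwise_lt E hσ
  rw [hF.sum_active hl' fun B hB x hx => by simpa [hl.mem_iff] using hE B hB hx,
    hF.sum_active hk' fun B hB x hx => by simpa [hk.mem_iff] using hE B hB hx]
  exact Exchange.tutte_perm (hl.trans hk.symm) hF

end Activity

section BallotSets

/-- The number of elements of `S` smaller than `c`. -/
def below (S : Finset ℕ) (c : ℕ) : ℕ := (S.filter fun x => x < c).card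

/-- The column sets of north blocks of `m × n` rational Dyck paths of composition type `α`. -/
noncomputable def ballotSets (m n : ℕ) (α : List ℕ) : Finset (Finset ℕ) :=
  (Finset.range m).powerset.filter fun S =>
    S.card = α.length ∧ ∀ c ≤ m, c * n ≤ (α.take (below S c)).sum * m

theorem mem_ballotSets {m n : ℕ} {α : List ℕ} {S : Finset ℕ} :
    S ∈ ballotSets m n α ↔ S ⊆ Finset.range m ∧ S.card = α.length ∧
      ∀ c ≤ m, c * n ≤ (α.take (below S c)).sum * m := by
  simp [ballotSets]

theorem below_mono_set {S T : Finset ℕ} {c : ℕ} (h : ∀ x ∈ S, x < c → x ∈ T) :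
    below S c ≤ below T c := by
  apply Finset.card_le_card
  intro x
  simp only [Finset.mem_filter]
  grind

theorem below_succ_of_mem {S : Finset ℕ} {c : ℕ} (h : c ∈ S) : below S (c + 1) = below S c + 1 := by
  have : (S.filter fun x => x < c + 1) = insert c (S.filter fun x => x < c) := by
    ext x
    simp only [Finset.mem_filter, Finset.mem_insert]
    grind
  rw [below, this, Finset.card_insert_of_notMem (by simp), below]

theorem below_succ_of_notMem {S : Finset ℕ} {c : ℕ} (h : c ∉ S) : below S (c + 1) = below S c := by
  have : (S.filter fun x => x < c + 1) = S.filter fun x => x < c := by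
    ext x
    simp only [Finset.mem_filter]
    grind
  rw [below, this, below]

theorem below_eq_card {S : Finset ℕ} {m c : ℕ} (hS : S ⊆ Finset.range m) (hc : m ≤ c) :
    below S c = S.card := by
  rw [below, Finset.filter_true_of_mem]
  intro x hx
  have := Finset.mem_range.1 (hS hx)
  omega

theorem below_le_card (S : Finset ℕ) (c : ℕ) : below S c ≤ S.card :=
  Finset.card_filter_le _ _

theorem below_insert {S : Finset ℕ} {g : ℕ} (hg : g ∉ S) (c : ℕ) :
    below (insert g S) c = below S c + if g < c then 1 else 0 := by
  rw [below, below, Finset.filter_insert]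
  split_ifs with h
  · rw [Finset.card_insert_of_notMem (by simp [hg])]
  · rfl

theorem below_exchange {S : Finset ℕ} {e g : ℕ} (he : e ∈ S) (hg : g ∉ S) (c : ℕ) :
    below (insert g (S.erase e)) c + (if e < c then 1 else 0) =
      below S c + if g < c then 1 else 0 := by
  have h₁ := below_insert (Finset.notMem_erase e S) c
  have h₂ := below_insert (S := S.erase e) (g := g) (by grind) c
  rw [Finset.insert_erase he] at h₁
  omega

theorem card_exchange {S : Finset ℕ} {e g : ℕ} (he : e ∈ S) (hg : g ∉ S) :
    (insert g (S.erase e)).card = S.card := by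
  rw [Finset.card_insert_of_notMem (by grind), Finset.card_erase_add_one he]

theorem sum_take_mono (α : List ℕ) : Monotone fun j => (α.take j).sum := by
  intro i j hij
  exact (List.take_sublist_take_left hij).sum_le_sum (by simp)

theorem sum_take_lt {α : List ℕ} (hα : ∀ a ∈ α, 0 < a) {j : ℕ} (hj : j < α.length) :
    (α.take j).sum < (α.take (j + 1)).sum := by
  rw [List.sum_take_succ _ _ hj]
  have := hα _ (List.getElem_mem hj)
  omega

theorem le_sum_take {α : List ℕ} (hα : ∀ a ∈ α, 0 < a) {j : ℕ} (hj : j ≤ α.length) :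
    j ≤ (α.take j).sum := by
  induction j with
  | zero => simp
  | succ j ih =>
    have := ih (by omega)
    have := sum_take_lt hα (j := j) (by omega)
    omega

theorem exchange_mem_ballotSets_iff {m n : ℕ} {α : List ℕ} {S : Finset ℕ}
    (hS : S ∈ ballotSets m n α) {e g : ℕ} (he : e ∈ S) (hg : g ∉ S) :
    insert g (S.erase e) ∈ ballotSets m n α ↔
      g < m ∧ ∀ c, e < c → c ≤ g → c * n ≤ (α.take (below S c - 1)).sum * m := by
  rw [mem_ballotSets] at hS ⊢
  obtain ⟨h₁, h₂, h₃⟩ := hS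
  rw [card_exchange he hg]
  constructor
  · rintro ⟨h₄, -, h₅⟩
    have hgm : g < m := Finset.mem_range.1 (h₄ (Finset.mem_insert_self _ _))
    refine ⟨hgm, fun c hec hcg => ?_⟩
    have := below_exchange he hg c
    rw [if_pos hec, if_neg (by omega)] at this
    have h := h₅ c (by omega)
    rwa [show below (insert g (S.erase e)) c = below S c - 1 by omega] at h
  · rintro ⟨hgm, h⟩
    refine ⟨?_, h₂, fun c hc => ?_⟩
    · intro x hx
      rcases Finset.mem_insert.1 hx with rfl | hx
      · simpa using hgm
      · exact h₁ (Finset.mem_of_mem_erase hx)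
    · have hx := below_exchange he hg c
      by_cases hcc : e < c ∧ c ≤ g
      · have h' := h c hcc.1 hcc.2
        rw [if_pos hcc.1, if_neg (by omega)] at hx
        rwa [show below S c - 1 = below (insert g (S.erase e)) c by omega] at h'
      · have : below S c ≤ below (insert g (S.erase e)) c := by
          split_ifs at hx <;> omega
        exact (h₃ c hc).trans (Nat.mul_le_mul_right _ (sum_take_mono α this))

theorem exchange_mem_of_lt {m n : ℕ} {α : List ℕ} {S : Finset ℕ}
    (hS : S ∈ ballotSets m n α) {e g : ℕ} (he : e ∈ S) (hg : g ∉ S) (hge : g < e) :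
    insert g (S.erase e) ∈ ballotSets m n α := by
  rw [exchange_mem_ballotSets_iff hS he hg]
  have := Finset.mem_range.1 ((mem_ballotSets.1 hS).1 he)
  exact ⟨by omega, fun c _ _ => by omega⟩

theorem exchange_ballotSets (m n : ℕ) (α : List ℕ) : Exchange (ballotSets m n α) := by
  intro A hA B hB e heA heB
  have hne : (B \ A).Nonempty := by
    rw [Finset.nonempty_iff_ne_empty]
    intro h
    have hsub : B ⊆ A := Finset.sdiff_eq_empty_iff_subset.1 h
    have hcard : A.card ≤ B.card := by
      rw [(mem_ballotSets.1 hA).2.1, (mem_ballotSets.1 hB).2.1]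
    exact heB (Finset.eq_of_subset_of_card_le hsub hcard ▸ heA)
  have hgmem := Finset.mem_sdiff.1 (Finset.min'_mem _ hne)
  have hmin : ∀ x ∈ B, x ∉ A → (B \ A).min' hne ≤ x := fun x hx hxA =>
    Finset.min'_le _ _ (Finset.mem_sdiff.2 ⟨hx, hxA⟩)
  generalize (B \ A).min' hne = g at hgmem hmin
  refine ⟨g, hgmem.1, hgmem.2, ?_⟩
  rw [exchange_mem_ballotSets_iff hA heA hgmem.2]
  have hgm := Finset.mem_range.1 ((mem_ballotSets.1 hB).1 hgmem.1)
  refine ⟨hgm, fun c hec hcg => ?_⟩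
  refine ((mem_ballotSets.1 hB).2.2 c (by omega)).trans
    (Nat.mul_le_mul_right _ (sum_take_mono α ?_))
  have h₁ : below B c ≤ below (A.erase e) c := below_mono_set fun x hx hxc => by
    have := hmin x hx
    grind
  have h₂ := below_insert (Finset.notMem_erase e A) c
  rw [Finset.insert_erase heA, if_pos hec] at h₂
  omega

theorem active_sub_ballotSets {m n : ℕ} (hn : 0 < n) (hmn : n < m) {α : List ℕ}
    (hα : IsComposition n α) {S : Finset ℕ} (hS : S ∈ ballotSets m n α) :
    active (fun e => m - e) (ballotSets m n α) S =
      S.filter fun e => (α.take (below S e)).sum * m < (e + 1) * n := by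
  ext e
  rw [mem_active, Finset.mem_filter]
  refine and_congr_right fun he => ?_
  have hS' := mem_ballotSets.1 hS
  have hem := Finset.mem_range.1 (hS'.1 he)
  constructor
  · intro h
    by_contra! hcon
    have key : ∀ d, (∀ x, e < x → x < e + 1 + d → x ∈ S) → e + 1 + d ≤ m →
        below S (e + 1 + d) = below S e + 1 + d ∧
        (e + 1 + d) * n ≤ (α.take (below S e + d)).sum * m := by
      intro d
      induction d with
      | zero => exact fun _ _ => ⟨below_succ_of_mem he, hcon⟩
      | succ d ih =>
        intro hd hdm
        obtain ⟨h₁, h₂⟩ := ih (fun x hx hx' => hd x hx (by omega)) (by omega)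
        have h₃ : below S (e + 1 + (d + 1)) = below S e + 1 + (d + 1) := by
          have := below_succ_of_mem (hd (e + 1 + d) (by omega) (by omega))
          rw [← add_assoc (e + 1), this, h₁]
          omega
        refine ⟨h₃, ?_⟩
        have h₄ := below_le_card S (e + 1 + (d + 1))
        have h₅ := sum_take_lt hα.1 (j := below S e + d) (by omega)
        rw [← add_assoc (below S e)]
        nlinarith
    by_cases hall : ∀ x, e < x → x < m → x ∈ S
    · obtain ⟨d, rfl⟩ := Nat.exists_eq_add_of_le (show e + 1 ≤ m from hem)
      obtain ⟨h₁, h₂⟩ := key d hall le_rfl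
      rw [below_eq_card hS'.1 le_rfl, hS'.2.1] at h₁
      have h₃ := sum_take_lt hα.1 (j := below S e + d) (by omega)
      have h₄ := sum_take_mono α (show below S e + d + 1 ≤ α.length by omega)
      simp only [List.take_length, hα.2] at h₄
      nlinarith
    · push Not at hall
      have hex : ∃ x, e < x ∧ x < m ∧ x ∉ S := hall
      have hg := Nat.find_spec hex
      have hmin := fun x hx => Nat.find_min hex (m := x) hx
      generalize Nat.find hex = g at hg hmin
      refine h g hg.2.2 (by omega) ((exchange_mem_ballotSets_iff hS he hg.2.2).2 ⟨hg.2.1, ?_⟩)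
      intro c hc hcg
      obtain ⟨d, rfl⟩ := Nat.exists_eq_add_of_le (show e + 1 ≤ c from hc)
      obtain ⟨h₁, h₂⟩ := key d (fun x hx hx' => by
        by_contra hxS
        exact hmin x (by omega) ⟨hx, by omega, hxS⟩) (by omega)
      rwa [h₁, show below S e + 1 + d - 1 = below S e + d by omega]
  · intro h g hg hlt hmem
    rw [exchange_mem_ballotSets_iff hS he hg] at hmem
    have := hmem.2 (e + 1) (by omega) (by omega)
    rw [below_succ_of_mem he, Nat.add_sub_cancel] at this
    omega

theorem zero_mem_of_mem_ballotSets {m n : ℕ} (hn : 0 < n) (hm : 0 < m) {α : List ℕ}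
    {S : Finset ℕ} (hS : S ∈ ballotSets m n α) : 0 ∈ S := by
  by_contra h0
  have h₁ := (mem_ballotSets.1 hS).2.2 1 hm
  have h₂ := below_succ_of_notMem h0
  rw [zero_add] at h₂
  rw [h₂, show below S 0 = 0 by simp [below]] at h₁
  simp at h₁
  omega

/-- The order on `{0, …, m - 1}` listing the multiples of `k` first, as a ranking. -/
def multiplesFirst (m k e : ℕ) : ℕ := if k ∣ e then e else e + m

theorem multiplesFirst_injOn (m k : ℕ) :
    Set.InjOn (multiplesFirst m k) (Finset.range m : Finset ℕ) := by
  intro a ha b hb h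
  simp only [Finset.coe_range, Set.mem_Iio] at ha hb
  unfold multiplesFirst at h
  split_ifs at h <;> omega

theorem le_below_of_multiples_mem {S : Finset ℕ} {k e c : ℕ} (he : e ∈ S)
    (hke : ¬ k ∣ e) (hec : e < c) {u : ℕ} (hu : ∀ i < u, k * i ∈ S ∧ k * i < c) (hk : 0 < k) :
    u + 1 ≤ below S c := by
  have hsub : insert e ((Finset.range u).image fun i => k * i) ⊆ S.filter fun x => x < c := by
    intro x
    simp only [Finset.mem_insert, Finset.mem_image, Finset.mem_range, Finset.mem_filter]
    rintro (rfl | ⟨i, hi, rfl⟩)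
    · exact ⟨he, hec⟩
    · exact hu i hi
  have := Finset.card_le_card hsub
  rwa [Finset.card_insert_of_notMem, Finset.card_image_of_injective, Finset.card_range] at this
  · intro a b hab
    exact Nat.eq_of_mul_eq_mul_left hk hab
  · simp only [Finset.mem_image, not_exists, not_and]
    rintro i - rfl
    exact hke (dvd_mul_right _ _)

theorem active_multiplesFirst_ballotSets {m n k : ℕ} (hk : 0 < k) (hkm : k * n ≤ m)
    {α : List ℕ} (hα : IsComposition n α) {S : Finset ℕ} (hS : S ∈ ballotSets m n α) :
    active (multiplesFirst m k) (ballotSets m n α) S =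
      S.filter fun e => k ∣ e ∧ ∀ i, k * i < e → k * i ∈ S := by
  have hS' := mem_ballotSets.1 hS
  ext e
  rw [mem_active, Finset.mem_filter]
  refine and_congr_right fun he => ?_
  have hem := Finset.mem_range.1 (hS'.1 he)
  constructor
  · intro h
    have hmul : ∀ i, k * i < e → k * i ∈ S := by
      intro i hi
      by_contra hiS
      refine h _ hiS ?_ (exchange_mem_of_lt hS he hiS hi)
      simp only [multiplesFirst, dvd_mul_right, if_true]
      split_ifs <;> omega
    refine ⟨?_, hmul⟩
    by_contra hke
    have hex : ∃ i, k * i ∉ S := ⟨m, fun hm => by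
      have := Finset.mem_range.1 (hS'.1 hm)
      nlinarith⟩
    have hc := Nat.find_spec hex
    have hmin := fun x hx => not_not.1 (Nat.find_min hex (m := x) hx)
    generalize Nat.find hex = c at hc hmin
    have hec : e < k * c := by
      by_contra! hle
      rcases hle.lt_or_eq with hlt | heq
      · exact hc (hmul c hlt)
      · exact hc (heq ▸ he)
    have key : ∀ x, e < x → x ≤ k * c → x ≤ m → ∃ u, u + 1 ≤ below S x ∧ x * n ≤ u * m := by
      intro x hex hxc hxm
      refine ⟨(x + k - 1) / k, le_below_of_multiples_mem he hke hex (fun i hi => ?_) hk, ?_⟩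
      · have h₁ : k * i < x := by
          have h₂ : (i + 1) * k ≤ x + k - 1 := (Nat.le_div_iff_mul_le hk).1 hi
          have : (i + 1) * k = k * i + k := by ring
          omega
        exact ⟨hmin i (lt_of_mul_lt_mul_left (h₁.trans_le hxc) (Nat.zero_le k)), h₁⟩
      · have h₁ : x ≤ k * ((x + k - 1) / k) := by
          have := Nat.div_add_mod (x + k - 1) k
          have := Nat.mod_lt (x + k - 1) hk
          omega
        calc x * n ≤ k * ((x + k - 1) / k) * n := Nat.mul_le_mul_right _ h₁
          _ = ((x + k - 1) / k) * (k * n) := by ring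
          _ ≤ _ := Nat.mul_le_mul_left _ hkm
    have hkey : ∀ x, e < x → x ≤ k * c → x ≤ m →
        x * n ≤ (α.take (below S x - 1)).sum * m := by
      intro x h₁ h₂ h₃
      obtain ⟨u, hu, hx⟩ := key x h₁ h₂ h₃
      have h₄ := below_le_card S x
      have h₅ := le_sum_take hα.1 (j := u) (by omega)
      have h₆ := sum_take_mono α (show u ≤ below S x - 1 by omega)
      exact hx.trans (Nat.mul_le_mul_right _ (h₅.trans h₆))
    have hcm : k * c < m := by
      by_contra! hmc
      have h₁ := hkey m hem hmc le_rfl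
      rw [below_eq_card hS'.1 le_rfl, hS'.2.1] at h₁
      have hpos : 0 < α.length := by
        rw [← hS'.2.1]
        exact Finset.card_pos.2 ⟨e, he⟩
      have h₂ := sum_take_lt hα.1 (j := α.length - 1) (by omega)
      rw [Nat.sub_add_cancel hpos, List.take_length, hα.2] at h₂
      nlinarith
    refine h _ hc ?_ ((exchange_mem_ballotSets_iff hS he hc).2
      ⟨hcm, fun x h₁ h₂ => hkey x h₁ h₂ (by omega)⟩)
    simp only [multiplesFirst, dvd_mul_right, if_true, hke, if_false]
    omega
  · rintro ⟨hke, hmul⟩ g hg hlt hmem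
    rw [exchange_mem_ballotSets_iff hS he hg] at hmem
    simp only [multiplesFirst, hke, if_true] at hlt
    split_ifs at hlt with hkg
    · obtain ⟨i, rfl⟩ := hkg
      exact hg (hmul i hlt)
    · omega

theorem card_active_multiplesFirst {m n k : ℕ} (hn : 0 < n) (hk : 0 < k) (hkm : k * n ≤ m)
    {α : List ℕ} (hα : IsComposition n α) {S : Finset ℕ} (hS : S ∈ ballotSets m n α) :
    (active (multiplesFirst m k) (ballotSets m n α) S).card =
      sInf {i : ℕ | 1 ≤ i ∧ i ≤ n ∧ k * i ∉ S} := by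
  have hm : 0 < m := lt_of_lt_of_le (Nat.mul_pos hk hn) hkm
  have h0 := zero_mem_of_mem_ballotSets hn hm hS
  have hS' := mem_ballotSets.1 hS
  have hinj : Function.Injective fun i => k * i := fun a b hab => Nat.eq_of_mul_eq_mul_left hk hab
  have hne : {i : ℕ | 1 ≤ i ∧ i ≤ n ∧ k * i ∉ S}.Nonempty := by
    by_contra hemp
    rw [Set.not_nonempty_iff_eq_empty, Set.eq_empty_iff_forall_notMem] at hemp
    have hsub : (Finset.range (n + 1)).image (fun i => k * i) ⊆ S := by
      intro x hx
      obtain ⟨i, hi, rfl⟩ := Finset.mem_image.1 hx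
      rw [Finset.mem_range] at hi
      by_contra hiS
      refine hemp i ⟨?_, by omega, hiS⟩
      rcases Nat.eq_zero_or_pos i with rfl | h
      · simp [h0] at hiS
      · exact h
    have := Finset.card_le_card hsub
    rw [Finset.card_image_of_injective _ hinj, Finset.card_range, hS'.2.1] at this
    have h₂ := le_sum_take hα.1 le_rfl
    rw [List.take_length, hα.2] at h₂
    omega
  have ht := Nat.sInf_mem hne
  have hmin := fun i (hi : i < sInf {i : ℕ | 1 ≤ i ∧ i ≤ n ∧ k * i ∉ S}) => Nat.notMem_of_lt_sInf hi
  generalize sInf {i : ℕ | 1 ≤ i ∧ i ≤ n ∧ k * i ∉ S} = t at ht hmin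
  obtain ⟨ht₁, ht₂, ht₃⟩ := ht
  have hmem : ∀ i < t, k * i ∈ S := by
    intro i hi
    by_contra hiS
    refine hmin i hi ⟨?_, by omega, hiS⟩
    rcases Nat.eq_zero_or_pos i with rfl | h
    · simp [h0] at hiS
    · exact h
  rw [active_multiplesFirst_ballotSets hk hkm hα hS, ← Finset.card_range t,
    ← Finset.card_image_of_injective (Finset.range t) hinj]
  congr 1
  ext e
  simp only [Finset.mem_filter, Finset.mem_image, Finset.mem_range]
  constructor
  · rintro ⟨he, ⟨j, rfl⟩, h⟩
    refine ⟨j, ?_, rfl⟩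
    by_contra! hle
    rcases hle.lt_or_eq with hlt | rfl
    · exact ht₃ (h t (Nat.mul_lt_mul_of_pos_left hlt hk))
    · exact ht₃ he
  · rintro ⟨j, hj, rfl⟩
    exact ⟨hmem j hj, dvd_mul_right _ _, fun i hi =>
      hmem i ((lt_of_mul_lt_mul_left hi (Nat.zero_le k)).trans hj)⟩

end BallotSets

section Blocks

/-- The path with `h` north steps in column `0` and as many north steps in the columns
`1, 2, …` as listed. -/
def ofBlocks : ℕ → List ℕ → Path
  | h, [] => List.replicate h true
  | h, h' :: t => List.replicate h true ++ false :: ofBlocks h' t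

theorem exists_eq_ofBlocks (P : Path) : ∃ h t, P = ofBlocks h t := by
  induction P with
  | nil => exact ⟨0, [], rfl⟩
  | cons b P ih =>
    obtain ⟨h, t, rfl⟩ := ih
    cases b
    · exact ⟨0, h :: t, rfl⟩
    · refine ⟨h + 1, t, ?_⟩
      cases t <;> rfl

theorem count_false_ofBlocks (h : ℕ) (t : List ℕ) : (ofBlocks h t).count false = t.length := by
  induction t generalizing h with
  | nil => simp [ofBlocks, List.count_replicate]
  | cons h' t ih => simp [ofBlocks, List.count_replicate, ih]

theorem count_true_ofBlocks (h : ℕ) (t : List ℕ) : (ofBlocks h t).count true = (h :: t).sum := by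
  induction t generalizing h with
  | nil => simp [ofBlocks]
  | cons h' t ih => simp [ofBlocks, ih]

theorem map_length_splitOn_ofBlocks (h : ℕ) (t : List ℕ) :
    ((ofBlocks h t).splitOn false).map List.length = h :: t := by
  induction t generalizing h with
  | nil =>
    rw [ofBlocks, List.splitOn_eq_singleton (by simp)]
    simp
  | cons h' t ih =>
    rw [ofBlocks, List.splitOn_append_cons_self_of_not_mem (by simp), List.map_cons, ih]
    simp

theorem compType_ofBlocks (h : ℕ) (t : List ℕ) :
    compType (ofBlocks h t) = (h :: t).filter fun x => x ≠ 0 := by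
  rw [compType, map_length_splitOn_ofBlocks]

theorem coarea_cons (b : Bool) (P : Path) :
    coarea (b :: P) = if b then 0 :: coarea P else (coarea P).map (· + 1) := by
  rw [coarea, List.length_cons, List.range_succ_eq_map]
  cases b <;>
  simp [coarea, List.filterMap_map, List.map_filterMap,
    apply_ite (Option.map _)]

theorem mem_coarea_replicate_append (h c : ℕ) (P : Path) :
    c ∈ coarea (List.replicate h true ++ P) ↔ c = 0 ∧ h ≠ 0 ∨ c ∈ coarea P := by
  induction h with
  | zero => simp
  | succ h ih =>
    rw [List.replicate_succ, List.cons_append, coarea_cons]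
    simp only [if_true, List.mem_cons, ih]
    tauto

theorem mem_coarea_ofBlocks (h c : ℕ) (t : List ℕ) :
    c ∈ coarea (ofBlocks h t) ↔ (h :: t).getD c 0 ≠ 0 := by
  induction t generalizing h c with
  | nil =>
    have := mem_coarea_replicate_append h c []
    rw [List.append_nil] at this
    rw [ofBlocks, this]
    cases c <;> simp [coarea]
  | cons h' t ih =>
    rw [ofBlocks, mem_coarea_replicate_append, coarea_cons]
    cases c with
    | zero => simp
    | succ c => simp [ih]

theorem prefRank_cons (m n : ℕ) (b : Bool) (P : Path) :
    prefRank m n (b :: P) = (if b then (m : ℤ) else -n) + prefRank m n P := by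
  cases b <;> simp [prefRank] <;> ring

/-- The path `P`, started at a point of rank `z`, visits only points of nonnegative rank. -/
def StaysAbove (m n : ℕ) (z : ℤ) (P : Path) : Prop :=
  ∀ i ≤ P.length, 0 ≤ z + prefRank m n (P.take i)

theorem staysAbove_nil (m n : ℕ) (z : ℤ) : StaysAbove m n z [] ↔ 0 ≤ z := by
  simp [StaysAbove, prefRank]

theorem staysAbove_cons (m n : ℕ) (z : ℤ) (b : Bool) (P : Path) :
    StaysAbove m n z (b :: P) ↔ 0 ≤ z ∧ StaysAbove m n (z + if b then (m : ℤ) else -n) P := by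
  constructor
  · intro h
    refine ⟨by simpa [prefRank] using h 0 (by simp), fun i hi => ?_⟩
    have := h (i + 1) (by simpa using hi)
    rw [List.take_succ_cons, prefRank_cons] at this
    linarith
  · rintro ⟨h₀, h⟩ i hi
    cases i with
    | zero => simpa [prefRank] using h₀
    | succ i =>
      have := h i (by simpa using hi)
      rw [List.take_succ_cons, prefRank_cons]
      linarith

theorem StaysAbove.nonneg {m n : ℕ} {z : ℤ} {P : Path} (h : StaysAbove m n z P) : 0 ≤ z := by
  simpa [prefRank] using h 0 (by simp)

theorem staysAbove_replicate_append (m n h : ℕ) (z : ℤ) (P : Path) :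
    StaysAbove m n z (List.replicate h true ++ P) ↔ 0 ≤ z ∧ StaysAbove m n (z + h * m) P := by
  induction h generalizing z with
  | zero =>
    simp only [List.replicate_zero, List.nil_append, Nat.cast_zero, zero_mul, add_zero]
    exact ⟨fun h => ⟨h.nonneg, h⟩, fun h => h.2⟩
  | succ h ih =>
    rw [List.replicate_succ, List.cons_append, staysAbove_cons, ih, if_pos rfl,
      show z + m + h * m = z + ((h + 1 : ℕ) : ℤ) * m by push_cast; ring]
    constructor
    · exact fun h => ⟨h.1, h.2.2⟩
    · exact fun h => ⟨h.1, by have := h.1; positivity, h.2⟩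

theorem staysAbove_ofBlocks (m n h : ℕ) (z : ℤ) (t : List ℕ) :
    StaysAbove m n z (ofBlocks h t) ↔
      ∀ c ≤ t.length, 0 ≤ z + (((h :: t).take c).sum : ℤ) * m - c * n := by
  induction t generalizing z h with
  | nil =>
    have := staysAbove_replicate_append m n h z []
    rw [List.append_nil, staysAbove_nil] at this
    rw [ofBlocks, this]
    simp only [List.length_nil, nonpos_iff_eq_zero, forall_eq]
    simp
    intro h
    positivity
  | cons h' t ih =>
    rw [ofBlocks, staysAbove_replicate_append, staysAbove_cons, ih]
    have hstep : ∀ c : ℕ, z + (((h :: h' :: t).take (c + 1)).sum : ℤ) * m - ((c + 1 : ℕ) : ℤ) * n =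
        z + h * m + (if false = true then (m : ℤ) else -n) +
          (((h' :: t).take c).sum : ℤ) * m - c * n := by
      intro c
      simp
      ring
    constructor
    · rintro ⟨h₀, -, h₁⟩ c hc
      cases c with
      | zero => simpa using h₀
      | succ c => rw [hstep]; exact h₁ c (by simpa using hc)
    · intro hall
      have h₀ : 0 ≤ z := by simpa using hall 0 (by simp)
      refine ⟨h₀, by positivity, fun c hc => ?_⟩
      rw [← hstep]
      exact hall (c + 1) (by simpa using hc)

/-- The number of points of rank less than `n` on `P` started at rank `z`, the endpoint excluded. -/
def lowPoints (m n : ℕ) (z : ℤ) (P : Path) : ℕ :=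
  ((List.range P.length).filter fun i => z + prefRank m n (P.take i) < (n : ℤ)).length

theorem lowPoints_cons (m n : ℕ) (z : ℤ) (b : Bool) (P : Path) :
    lowPoints m n z (b :: P) =
      (if z < n then 1 else 0) + lowPoints m n (z + if b then (m : ℤ) else -n) P := by
  have h : ∀ i, z + prefRank m n ((b :: P).take (i + 1)) =
      (z + if b then (m : ℤ) else -n) + prefRank m n (P.take i) := by
    intro i
    rw [List.take_succ_cons, prefRank_cons, add_assoc]
  rw [lowPoints, List.length_cons, List.range_succ_eq_map, List.filter_cons, List.filter_map,
    lowPoints]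
  simp only [Function.comp_def, Nat.succ_eq_add_one, h]
  have h₀ : z + prefRank m n ((b :: P).take 0) = z := by simp [prefRank]
  rw [h₀]
  split_ifs <;> simp_all <;> omega

theorem lowPoints_replicate_append {m n : ℕ} (hmn : n ≤ m) (h : ℕ) {z : ℤ} (hz : 0 ≤ z)
    (P : Path) :
    lowPoints m n z (List.replicate h true ++ P) =
      (if h ≠ 0 ∧ z < n then 1 else 0) + lowPoints m n (z + h * m) P := by
  induction h generalizing z with
  | zero => simp
  | succ h ih =>
    rw [List.replicate_succ, List.cons_append, lowPoints_cons]
    simp only [↓reduceIte]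
    rw [ih (z := z + m) (by positivity),
      show z + m + h * m = z + ((h + 1 : ℕ) : ℤ) * m by push_cast; ring,
      if_neg (c := h ≠ 0 ∧ _) (by omega)]
    simp

theorem lowPoints_ofBlocks {m n : ℕ} (hmn : n ≤ m) (h : ℕ) (t : List ℕ) {z : ℤ}
    (hz : StaysAbove m n z (ofBlocks h t)) :
    lowPoints m n z (ofBlocks h t) = ∑ c ∈ Finset.range (t.length + 1),
      if (h :: t).getD c 0 ≠ 0 ∧ z + (((h :: t).take c).sum : ℤ) * m - c * n < n
        then 1 else 0 := by
  induction t generalizing z h with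
  | nil =>
    have := lowPoints_replicate_append hmn h hz.nonneg []
    rw [List.append_nil] at this
    rw [ofBlocks, this, List.length_nil, zero_add, Finset.sum_range_one]
    simp [lowPoints]
  | cons h' t ih =>
    have hz₀ := hz.nonneg
    rw [ofBlocks, staysAbove_replicate_append, staysAbove_cons] at hz
    have hz₁ := hz.2.2.nonneg
    rw [ofBlocks, lowPoints_replicate_append hmn h hz₀, lowPoints_cons, ih _ hz.2.2,
      List.length_cons, Finset.sum_range_succ' _ (t.length + 1), if_neg (c := z + _ < _),
      zero_add, add_comm]
    · congr 1
      · refine Finset.sum_congr rfl fun c _ => if_congr ?_ rfl rfl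
        rw [List.getD_cons_succ, List.take_succ_cons, List.sum_cons]
        rw [show z + h * m + (if false = true then (m : ℤ) else -n) +
            (((h' :: t).take c).sum : ℤ) * m - c * n =
          z + ((h + ((h' :: t).take c).sum : ℕ) : ℤ) * m - ((c + 1 : ℕ) : ℤ) * n by simp; ring]
      · simp
    · simp at hz₁
      omega

/-- The nonzero positions of a list. -/
def support (H : List ℕ) : Finset ℕ := (Finset.range H.length).filter fun c => H.getD c 0 ≠ 0

theorem mem_support {H : List ℕ} {c : ℕ} : c ∈ support H ↔ H.getD c 0 ≠ 0 := by
  simp only [support, Finset.mem_filter, Finset.mem_range, and_iff_right_iff_imp]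
  intro h
  by_contra! hc
  exact h (List.getD_eq_default _ _ hc)

theorem length_filter_take (H : List ℕ) (c : ℕ) :
    ((H.take c).filter fun x => x ≠ 0).length = below (support H) c := by
  induction c with
  | zero => simp [below]
  | succ c ih =>
    by_cases hc : c < H.length
    · rw [List.take_succ_eq_append_getElem hc, List.filter_append, List.length_append, ih]
      by_cases h0 : H[c] = 0
      · rw [below_succ_of_notMem (by simp [mem_support, hc, h0])]
        simp [h0]
      · rw [below_succ_of_mem (by simp [mem_support, hc, h0])]
        simp [h0]
    · rw [below_succ_of_notMem (by simp [mem_support, hc]), ← ih,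
        List.take_of_length_le (by omega), List.take_of_length_le (by omega)]

theorem sum_filter_ne_zero (l : List ℕ) : (l.filter fun x => x ≠ 0).sum = l.sum := by
  induction l with
  | nil => rfl
  | cons a l ih =>
    rw [List.filter_cons]
    split_ifs with h
    · simp_all
    · simp_all

theorem sum_take_eq (H : List ℕ) (c : ℕ) :
    (H.take c).sum = ((H.filter fun x => x ≠ 0).take (below (support H) c)).sum := by
  have hpre : H.take c <+: H := ⟨H.drop c, List.take_append_drop c H⟩
  have h := hpre.filter fun x => decide (x ≠ 0)
  rw [List.prefix_iff_eq_take, length_filter_take] at h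
  rw [← h, sum_filter_ne_zero]

theorem exists_support_eq (S : Finset ℕ) (M : ℕ) :
    ∀ α : List ℕ, (∀ a ∈ α, 0 < a) → below S M = α.length →
      ∃ H : List ℕ, H.length = M ∧ (H.filter fun x => x ≠ 0) = α ∧
        ∀ c < M, H.getD c 0 ≠ 0 ↔ c ∈ S := by
  induction M with
  | zero =>
    intro α _ hS
    refine ⟨[], rfl, ?_, by simp⟩
    rw [show below S 0 = 0 by simp [below]] at hS
    exact (List.eq_nil_of_length_eq_zero hS.symm).symm
  | succ M ih =>
    intro α hα hS
    have step : ∀ x : ℕ, ∀ β : List ℕ, (∀ a ∈ β, 0 < a) → below S M = β.length →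
        (x ≠ 0 ↔ M ∈ S) → β ++ [x].filter (fun x => x ≠ 0) = α →
        ∃ H : List ℕ, H.length = M + 1 ∧ (H.filter fun x => x ≠ 0) = α ∧
          ∀ c < M + 1, H.getD c 0 ≠ 0 ↔ c ∈ S := by
      intro x β hβ hlen hx hβα
      obtain ⟨H, h₁, h₂, h₃⟩ := ih β hβ hlen
      refine ⟨H ++ [x], by simp [h₁], by rw [List.filter_append, h₂, hβα], fun c hc => ?_⟩
      rcases Nat.lt_succ_iff_lt_or_eq.1 hc with hc | rfl
      · rw [List.getD_append _ _ _ _ (by omega)]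
        exact h₃ c hc
      · rw [List.getD_append_right _ _ _ _ (by omega), h₁]
        simpa using hx
    by_cases hM : M ∈ S
    · rw [below_succ_of_mem hM] at hS
      rcases List.eq_nil_or_concat' α with rfl | ⟨β, x, rfl⟩
      · simp at hS
      · have hx : x ≠ 0 := (hα x (by simp)).ne'
        refine step x β (fun a ha => hα a (by simp [ha])) (by simpa using hS) (by simp [hx, hM]) ?_
        simp [hx]
    · rw [below_succ_of_notMem hM] at hS
      exact step 0 α hα hS (by simp [hM]) (by simp)

end Blocks

section Bijection

theorem mem_dyckPathsComp {m n : ℕ} {α : List ℕ} {P : Path} :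
    P ∈ dyckPathsComp m n α ↔ IsDyck m n P ∧ compType P = α := by
  simp only [dyckPathsComp, dyckPaths, Finset.mem_filter, Finset.mem_image, Finset.mem_univ,
    true_and, and_congr_left_iff, and_iff_right_iff_imp]
  intro _ h
  have hlen : m + n = P.length := by
    have := List.count_false_add_count_true P
    rw [h.1, h.2.1] at this
    exact this
  subst_vars
  rw [hlen]
  exact ⟨P.get, List.ofFn_get P⟩

theorem ofBlocks_mem_dyckPathsComp {m n : ℕ} {α : List ℕ} (hα : IsComposition n α)
    (h : ℕ) (t : List ℕ) :
    ofBlocks h t ∈ dyckPathsComp m n α ↔ t.length = m ∧ ((h :: t).filter fun x => x ≠ 0) = α ∧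
      ∀ c ≤ m, c * n ≤ (α.take (below (support (h :: t)) c)).sum * m := by
  have habove : (∀ i ≤ (ofBlocks h t).length, 0 ≤ prefRank m n ((ofBlocks h t).take i)) ↔
      StaysAbove m n 0 (ofBlocks h t) := by simp [StaysAbove]
  rw [mem_dyckPathsComp, IsDyck, habove, staysAbove_ofBlocks, count_false_ofBlocks,
    count_true_ofBlocks, compType_ofBlocks]
  have key : ∀ c : ℕ, 0 ≤ (0 : ℤ) + (((h :: t).take c).sum : ℤ) * m - c * n ↔
      c * n ≤ (((h :: t).filter fun x => x ≠ 0).take (below (support (h :: t)) c)).sum * m := by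
    intro c
    rw [← sum_take_eq]
    zify
    constructor <;> intro <;> linarith
  simp only [key]
  constructor
  · rintro ⟨⟨rfl, -, h₁⟩, rfl⟩
    exact ⟨rfl, rfl, h₁⟩
  · rintro ⟨rfl, rfl, h₁⟩
    refine ⟨⟨rfl, ?_, h₁⟩, rfl⟩
    rw [← sum_filter_ne_zero, hα.2]

/-- The set of columns containing north steps of `P`. -/
def columns (P : Path) : Finset ℕ := (coarea P).toFinset

theorem columns_ofBlocks (h : ℕ) (t : List ℕ) : columns (ofBlocks h t) = support (h :: t) := by
  ext c
  rw [columns, List.mem_toFinset, mem_coarea_ofBlocks, mem_support]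

theorem columns_mem_ballotSets {m n : ℕ} (hm : 0 < m) {α : List ℕ}
    (hα : IsComposition n α) {P : Path} (hP : P ∈ dyckPathsComp m n α) :
    columns P ∈ ballotSets m n α := by
  obtain ⟨h, t, rfl⟩ := exists_eq_ofBlocks P
  rw [ofBlocks_mem_dyckPathsComp hα] at hP
  obtain ⟨hlen, hfil, hle⟩ := hP
  rw [columns_ofBlocks, mem_ballotSets]
  have hsub : ∀ x ∈ support (h :: t), x < m + 1 := by
    intro x hx
    have := (Finset.mem_filter.1 hx).1
    simpa [hlen] using this
  have hcard : (support (h :: t)).card = α.length := by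
    rw [← hfil, ← below_eq_card (m := m + 1) (c := m + 1)
      (fun x hx => Finset.mem_range.2 (hsub x hx)) le_rfl, ← length_filter_take,
      List.take_of_length_le (by simp [hlen])]
  refine ⟨fun x hx => Finset.mem_range.2 ?_, hcard, hle⟩
  have hx' := hsub x hx
  by_contra! hmx
  obtain rfl : x = m := by omega
  have h₁ := below_succ_of_mem hx
  have h₂ := below_le_card (support (h :: t)) (x + 1)
  have h₃ := sum_take_lt hα.1 (j := below (support (h :: t)) x) (by omega)
  have h₄ := sum_take_mono α (show below (support (h :: t)) x + 1 ≤ α.length by omega)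
  simp only [List.take_length, hα.2] at h₄
  have h₅ := hle x le_rfl
  nlinarith

theorem columns_injOn {m n : ℕ} {α : List ℕ} (hα : IsComposition n α) :
    Set.InjOn columns (dyckPathsComp m n α : Set Path) := by
  intro P hP Q hQ hPQ
  rw [Finset.mem_coe] at hP hQ
  obtain ⟨h, t, rfl⟩ := exists_eq_ofBlocks P
  obtain ⟨h', t', rfl⟩ := exists_eq_ofBlocks Q
  rw [ofBlocks_mem_dyckPathsComp hα] at hP hQ
  rw [columns_ofBlocks, columns_ofBlocks] at hPQ
  have key : ∀ c, ((h :: t).take c).sum = ((h' :: t').take c).sum := by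
    intro c
    rw [sum_take_eq (h :: t), sum_take_eq (h' :: t'), hP.2.1, hQ.2.1, hPQ]
  have heq : h :: t = h' :: t' := by
    apply List.ext_getElem
    · simp [hP.1, hQ.1]
    · intro i h₁ h₂
      have h₃ := key (i + 1)
      rw [List.sum_take_succ _ _ h₁, List.sum_take_succ _ _ h₂, key i] at h₃
      omega
  rw [List.cons.injEq] at heq
  rw [heq.1, heq.2]

theorem columns_surjOn {m n : ℕ} {α : List ℕ} (hα : IsComposition n α) :
    Set.SurjOn columns (dyckPathsComp m n α : Set Path) (ballotSets m n α : Set (Finset ℕ)) := by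
  intro S hS
  rw [Finset.mem_coe, mem_ballotSets] at hS
  obtain ⟨hsub, hcard, hle⟩ := hS
  obtain ⟨H, h₁, h₂, h₃⟩ := exists_support_eq S (m + 1) α hα.1
    (by rw [below_eq_card hsub (Nat.le_succ m), hcard])
  rcases H with - | ⟨h, t⟩
  · simp at h₁
  have hsupp : support (h :: t) = S := by
    ext c
    rw [support, Finset.mem_filter, Finset.mem_range, h₁]
    constructor
    · exact fun hc => (h₃ c hc.1).1 hc.2
    · intro hc
      have hc' : c < m + 1 := (Finset.mem_range.1 (hsub hc)).trans (Nat.lt_succ_self m)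
      exact ⟨hc', (h₃ c hc').2 hc⟩
  refine ⟨ofBlocks h t, ?_, by rw [columns_ofBlocks, hsupp]⟩
  rw [Finset.mem_coe, ofBlocks_mem_dyckPathsComp hα, hsupp]
  exact ⟨by simpa using h₁, h₂, hle⟩

theorem sum_dyckPathsComp {m n : ℕ} (hm : 0 < m) {α : List ℕ} (hα : IsComposition n α)
    {stat : Path → ℕ} {f : Finset ℕ → ℕ}
    (h : ∀ P ∈ dyckPathsComp m n α, stat P = f (columns P)) :
    ∑ P ∈ dyckPathsComp m n α, (Polynomial.X : Polynomial ℚ) ^ stat P =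
      ∑ S ∈ ballotSets m n α, (Polynomial.X : Polynomial ℚ) ^ f S :=
  Finset.sum_nbij columns (fun _ hP => columns_mem_ballotSets hm hα hP) (columns_injOn hα)
    (columns_surjOn hα) fun P hP => by rw [h P hP]

theorem retStat_eq_card_active {m n : ℕ} (hn : 0 < n) (hmn : n < m) {α : List ℕ}
    (hα : IsComposition n α) {P : Path} (hP : P ∈ dyckPathsComp m n α) :
    retStat m n P = (active (fun e => m - e) (ballotSets m n α) (columns P)).card := by
  rw [active_sub_ballotSets hn hmn hα (columns_mem_ballotSets (by omega) hα hP)]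
  obtain ⟨h, t, rfl⟩ := exists_eq_ofBlocks P
  have hab : StaysAbove m n 0 (ofBlocks h t) := by
    simpa [StaysAbove] using (mem_dyckPathsComp.1 hP).1.2.2
  have hret : retStat m n (ofBlocks h t) = lowPoints m n 0 (ofBlocks h t) := by
    simp [retStat, lowPoints]
  rw [hret, lowPoints_ofBlocks hmn.le h t hab, ← Finset.card_filter, columns_ofBlocks]
  rw [ofBlocks_mem_dyckPathsComp hα] at hP
  congr 1
  ext c
  rw [Finset.mem_filter, Finset.mem_filter, ← hP.2.1, ← sum_take_eq, support, Finset.mem_filter,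
    List.length_cons, and_assoc]
  refine and_congr_right fun _ => and_congr_right fun _ => ?_
  zify
  constructor <;> intro <;> linarith

theorem sInf_eq_card_active {m n k : ℕ} (hn : 0 < n) (hk : 0 < k) (hkm : k * n ≤ m) {α : List ℕ}
    (hα : IsComposition n α) {P : Path} (hP : P ∈ dyckPathsComp m n α) :
    sInf {i : ℕ | 1 ≤ i ∧ i ≤ P.count true ∧ k * i ∉ coarea P} =
      (active (multiplesFirst m k) (ballotSets m n α) (columns P)).card := by
  have hm : 0 < m := lt_of_lt_of_le (Nat.mul_pos hk hn) hkm
  rw [card_active_multiplesFirst hn hk hkm hα (columns_mem_ballotSets hm hα hP),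
    (mem_dyckPathsComp.1 hP).1.2.1]
  simp only [columns, List.mem_toFinset]

end Bijection

/-- For `m > n` and a composition `α ⊨ n`, the statistics `ret`, `run`
and `r̃un` are equidistributed on `D_{m,α}`. -/
theorem equidistributed_comp (m n : ℕ) (hn : 0 < n) (hmn : n < m)
    (α : List ℕ) (hα : IsComposition n α) :
    (∑ P ∈ dyckPathsComp m n α, (Polynomial.X : Polynomial ℚ) ^ retStat m n P) =
        (∑ P ∈ dyckPathsComp m n α, (Polynomial.X : Polynomial ℚ) ^ runStat P) ∧
      (∑ P ∈ dyckPathsComp m n α, (Polynomial.X : Polynomial ℚ) ^ runStat P) =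
        ∑ P ∈ dyckPathsComp m n α, (Polynomial.X : Polynomial ℚ) ^ ratioRun m n P := by
  have hm : 0 < m := by omega
  have hexch := exchange_ballotSets m n α
  have hsub : ∀ S ∈ ballotSets m n α, S ⊆ Finset.range m := fun S hS => (mem_ballotSets.1 hS).1
  have hsubInj : Set.InjOn (fun e => m - e) (Finset.range m : Finset ℕ) := by
    intro a ha b hb hab
    simp only [Finset.coe_range, Set.mem_Iio] at ha hb hab
    omega
  have hk : 0 < m / n := Nat.div_pos hmn.le hn
  have hrun : ∀ P ∈ dyckPathsComp m n α, runStat P =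
      (active (multiplesFirst m 1) (ballotSets m n α) (columns P)).card := fun P hP => by
    rw [← sInf_eq_card_active hn one_pos (by omega) hα hP]
    simp only [runStat, one_mul]
  rw [sum_dyckPathsComp hm hα (f := fun S => (active (fun e => m - e) (ballotSets m n α) S).card)
      fun P hP => retStat_eq_card_active hn hmn hα hP,
    sum_dyckPathsComp hm hα
      (f := fun S => (active (multiplesFirst m 1) (ballotSets m n α) S).card) hrun,
    sum_dyckPathsComp hm hα (stat := ratioRun m n)
      (f := fun S => (active (multiplesFirst m (m / n)) (ballotSets m n α) S).card) fun P hP =>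
      sInf_eq_card_active hn hk (Nat.div_mul_le_self m n) hα hP]
  exact ⟨hexch.sum_active_eq _ hsub hsubInj (multiplesFirst_injOn m 1),
    hexch.sum_active_eq _ hsub (multiplesFirst_injOn m 1) (multiplesFirst_injOn m (m / n))⟩

end RationalDyck
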